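/- Let P ⊆ ℝ² be a nonempty bounded open connected set, let N ≥ 1 be a natural number, and let v : ℝ² → ℝ be continuously differentiable. Then there exists a unique real polynomial function q in two variables of total degree at most N such that (i) ∫_P ∇p · ∇q dx = ∫_P ∇p · ∇v dx for every polynomial p of total degree at most N, and (ii) ∫_P q dx = ∫_P v dx. -/

import Mathlib

open MeasureTheory RealInnerProductSpace

/-- Evaluation of a bivariate polynomial at a point of the Euclidean plane. -/
noncomputable def polyEval (q : MvPolynomial (Fin 2) ℝ) (x : EuclideanSpace ℝ (Fin 2)) : ℝ :=
  MvPolynomial.eval (fun i => x i) q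


lemma polyEval_contDiff (q : MvPolynomial (Fin 2) ℝ) : ContDiff ℝ 1 (polyEval q) := by
  induction q using MvPolynomial.induction_on with
  | C a =>
    have : polyEval (MvPolynomial.C a) = fun _ => a := by ext x; simp [polyEval]
    rw [this]; exact contDiff_const
  | add p q hp hq =>
    have : polyEval (p + q) = fun x => polyEval p x + polyEval q x := by ext x; simp [polyEval]
    rw [this]; exact hp.add hq
  | mul_X p i hp =>
    have : polyEval (p * MvPolynomial.X i) = fun x => polyEval p x * x i := by
      ext x; simp [polyEval]
    rw [this]; exact hp.mul (by fun_prop)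

lemma gradient_continuous {f : EuclideanSpace ℝ (Fin 2) → ℝ} (hf : ContDiff ℝ 1 f) : Continuous (gradient f) := by
  unfold gradient
  exact (LinearIsometryEquiv.continuous _).comp (hf.continuous_fderiv (by norm_num))

lemma polyEval_gradient_add (p q : MvPolynomial (Fin 2) ℝ) (x : EuclideanSpace ℝ (Fin 2)) :
    gradient (polyEval (p + q)) x = gradient (polyEval p) x + gradient (polyEval q) x := by
  have h : polyEval (p + q) = fun x => polyEval p x + polyEval q x := by ext x; simp [polyEval]
  have hp := (polyEval_contDiff p).differentiable (by norm_num) x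
  have hq := (polyEval_contDiff q).differentiable (by norm_num) x
  unfold gradient
  rw [h, fderiv_fun_add hp hq, map_add]

lemma polyEval_gradient_smul (c : ℝ) (q : MvPolynomial (Fin 2) ℝ) (x : EuclideanSpace ℝ (Fin 2)) :
    gradient (polyEval (c • q)) x = c • gradient (polyEval q) x := by
  have h : polyEval (c • q) = fun x => c • polyEval q x := by
    ext x; simp [polyEval, MvPolynomial.smul_eval]
  have hq := (polyEval_contDiff q).differentiable (by norm_num) x
  unfold gradient
  rw [h, fderiv_fun_const_smul hq, map_smul]

lemma integrableOn_of_cont {P : Set (EuclideanSpace ℝ (Fin 2))} (hPbdd : Bornology.IsBounded P) {f : EuclideanSpace ℝ (Fin 2) → ℝ}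
    (hf : Continuous f) : IntegrableOn f P :=
  (hf.continuousOn.integrableOn_compact hPbdd.isCompact_closure).mono_set subset_closure

lemma poly_eq_zero_of_open {P : Set (EuclideanSpace ℝ (Fin 2))} (hPne : P.Nonempty) (hPopen : IsOpen P)
    (q : MvPolynomial (Fin 2) ℝ) (h : ∀ x ∈ P, polyEval q x = 0) : q = 0 := by
  obtain ⟨x, hx⟩ := hPne
  have hU : IsOpen ((WithLp.toLp 2 : (Fin 2 → ℝ) → EuclideanSpace ℝ (Fin 2)) ⁻¹' P) :=
    hPopen.preimage (PiLp.continuous_toLp 2 _)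
  obtain ⟨r, hr, hb⟩ := Metric.isOpen_iff.1 hU (WithLp.ofLp x) (by simpa using hx)
  rw [ball_pi _ hr] at hb
  refine MvPolynomial.funext_set (fun i => Metric.ball (x i) r) (fun i => ?_) fun y hy => ?_
  · rw [Real.ball_eq_Ioo]; exact Set.Ioo_infinite (by linarith)
  · have := h _ (hb hy)
    simpa [polyEval] using this

/-- The Gram form. -/
noncomputable def gradInt (P : Set (EuclideanSpace ℝ (Fin 2))) (f g : EuclideanSpace ℝ (Fin 2) → ℝ) : ℝ :=
  ∫ x in P, ⟪gradient f x, gradient g x⟫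

lemma gradInt_integrable {P : Set (EuclideanSpace ℝ (Fin 2))} (hPbdd : Bornology.IsBounded P) {f g : EuclideanSpace ℝ (Fin 2) → ℝ}
    (hf : ContDiff ℝ 1 f) (hg : ContDiff ℝ 1 g) :
    IntegrableOn (fun x => ⟪gradient f x, gradient g x⟫) P :=
  integrableOn_of_cont hPbdd ((gradient_continuous hf).inner (gradient_continuous hg))

lemma gradInt_comm (P : Set (EuclideanSpace ℝ (Fin 2))) (f g : EuclideanSpace ℝ (Fin 2) → ℝ) : gradInt P f g = gradInt P g f := by
  unfold gradInt
  simp_rw [real_inner_comm]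

lemma gradInt_add {P : Set (EuclideanSpace ℝ (Fin 2))} (hPbdd : Bornology.IsBounded P) {g : EuclideanSpace ℝ (Fin 2) → ℝ}
    (hg : ContDiff ℝ 1 g) (p q : MvPolynomial (Fin 2) ℝ) :
    gradInt P (polyEval (p + q)) g = gradInt P (polyEval p) g + gradInt P (polyEval q) g := by
  unfold gradInt
  simp_rw [polyEval_gradient_add, inner_add_left]
  exact integral_add (gradInt_integrable hPbdd (polyEval_contDiff p) hg)
    (gradInt_integrable hPbdd (polyEval_contDiff q) hg)

lemma gradInt_smul (P : Set (EuclideanSpace ℝ (Fin 2))) (g : EuclideanSpace ℝ (Fin 2) → ℝ) (c : ℝ) (q : MvPolynomial (Fin 2) ℝ) :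
    gradInt P (polyEval (c • q)) g = c * gradInt P (polyEval q) g := by
  unfold gradInt
  simp_rw [polyEval_gradient_smul, real_inner_smul_left]
  exact integral_const_mul _ _

/-- The integral as a linear functional. -/
noncomputable def intLin (P : Set (EuclideanSpace ℝ (Fin 2))) (hPbdd : Bornology.IsBounded P) :
    MvPolynomial (Fin 2) ℝ →ₗ[ℝ] ℝ where
  toFun q := ∫ x in P, polyEval q x
  map_add' p q := by
    rw [← integral_add (integrableOn_of_cont hPbdd (polyEval_contDiff p).continuous)
      (integrableOn_of_cont hPbdd (polyEval_contDiff q).continuous)]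
    simp [polyEval]
  map_smul' c q := by
    simp only [polyEval, MvPolynomial.smul_eval, RingHom.id_apply, smul_eq_mul]
    exact integral_const_mul _ _

/-- Linear functional from pairing with a C¹ function. -/
noncomputable def pairLin (P : Set (EuclideanSpace ℝ (Fin 2))) (hPbdd : Bornology.IsBounded P) (v : EuclideanSpace ℝ (Fin 2) → ℝ)
    (hv : ContDiff ℝ 1 v) : MvPolynomial (Fin 2) ℝ →ₗ[ℝ] ℝ where
  toFun p := gradInt P (polyEval p) v
  map_add' p q := gradInt_add hPbdd hv p q
  map_smul' c q := gradInt_smul P v c q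

/-- The coercive form `∫ ∇p·∇q + (∫p)(∫q)`. -/
noncomputable def formLin (P : Set (EuclideanSpace ℝ (Fin 2))) (hPbdd : Bornology.IsBounded P) :
    MvPolynomial (Fin 2) ℝ →ₗ[ℝ] MvPolynomial (Fin 2) ℝ →ₗ[ℝ] ℝ where
  toFun q := pairLin P hPbdd (polyEval q) (polyEval_contDiff q)
    + intLin P hPbdd q • intLin P hPbdd
  map_add' p q := by
    refine LinearMap.ext fun r => ?_
    have : gradInt P (polyEval r) (polyEval (p + q)) =
        gradInt P (polyEval r) (polyEval p) + gradInt P (polyEval r) (polyEval q) := by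
      rw [gradInt_comm, gradInt_add hPbdd (polyEval_contDiff r), gradInt_comm,
        gradInt_comm P (polyEval q)]
    simp [pairLin, this]; ring
  map_smul' c q := by
    refine LinearMap.ext fun r => ?_
    have : gradInt P (polyEval r) (polyEval (c • q)) =
        c * gradInt P (polyEval r) (polyEval q) := by
      rw [gradInt_comm, gradInt_smul, gradInt_comm]
    simp [pairLin, this]; ring

lemma formLin_apply (P : Set (EuclideanSpace ℝ (Fin 2))) (hPbdd : Bornology.IsBounded P)
    (p q : MvPolynomial (Fin 2) ℝ) :
    formLin P hPbdd q p = gradInt P (polyEval p) (polyEval q)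
      + (∫ x in P, polyEval q x) * (∫ x in P, polyEval p x) := rfl

lemma vol_pos {P : Set (EuclideanSpace ℝ (Fin 2))} (hPne : P.Nonempty) (hPopen : IsOpen P)
    (hPbdd : Bornology.IsBounded P) : 0 < volume.real P := by
  rw [Measure.real, ENNReal.toReal_pos_iff]
  exact ⟨hPopen.measure_pos volume hPne, hPbdd.measure_lt_top⟩

lemma formLin_definite {P : Set (EuclideanSpace ℝ (Fin 2))} (hPne : P.Nonempty) (hPopen : IsOpen P)
    (hPbdd : Bornology.IsBounded P) (hPconn : IsConnected P)
    (q : MvPolynomial (Fin 2) ℝ) (h : formLin P hPbdd q q = 0) : q = 0 := by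
  rw [formLin_apply] at h
  have hnn : ∀ x, 0 ≤ ⟪gradient (polyEval q) x, gradient (polyEval q) x⟫ :=
    fun x => real_inner_self_nonneg
  have h0 : 0 ≤ gradInt P (polyEval q) (polyEval q) := integral_nonneg hnn
  have hI : (∫ x in P, polyEval q x) = 0 := by
    nlinarith [mul_self_nonneg (∫ x in P, polyEval q x)]
  have hG : gradInt P (polyEval q) (polyEval q) = 0 := by rw [hI] at h; linarith
  have hq := polyEval_contDiff q
  have hcont := (gradient_continuous hq).inner (𝕜 := ℝ) (gradient_continuous hq)
  have hae := (integral_eq_zero_iff_of_nonneg hnn (gradInt_integrable hPbdd hq hq)).1 hG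
  have heq := Measure.eqOn_open_of_ae_eq hae hPopen hcont.continuousOn continuousOn_const
  have hfd : Set.EqOn (fderiv ℝ (polyEval q)) 0 P := by
    intro x hx
    have h1 : gradient (polyEval q) x = 0 := inner_self_eq_zero.1 (heq hx)
    simpa [gradient] using h1
  obtain ⟨a, ha⟩ := hPopen.exists_is_const_of_fderiv_eq_zero hPconn.isPreconnected
    (hq.differentiable (by norm_num)).differentiableOn hfd
  have hv := vol_pos hPne hPopen hPbdd
  have hIa : (∫ x in P, polyEval q x) = volume.real P * a := by
    rw [setIntegral_congr_fun hPopen.measurableSet (g := fun _ => a) (fun x hx => ha x hx)]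
    simp
  have ha0 : a = 0 := by
    rw [hI] at hIa
    rcases mul_eq_zero.1 hIa.symm with h | h
    · exact absurd h hv.ne'
    · exact h
  exact poly_eq_zero_of_open hPne hPopen q fun x hx => by rw [ha x hx, ha0]

/-- Well-posedness of the elliptic VEM projector: on a nonempty bounded open connected set
`P ⊆ ℝ²`, for every C¹ function `v` and every `N ≥ 1` there exists a unique polynomial `q` of
total degree at most `N` such that `∫_P ∇p · ∇q = ∫_P ∇p · ∇v` for every polynomial `p` of
total degree at most `N`, and `∫_P q = ∫_P v`. -/
theorem stmt_8 (P : Set (EuclideanSpace ℝ (Fin 2))) (hPne : P.Nonempty)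
    (hPopen : IsOpen P) (hPbdd : Bornology.IsBounded P) (hPconn : IsConnected P)
    (N : ℕ) (hN : 1 ≤ N)
    (v : EuclideanSpace ℝ (Fin 2) → ℝ) (hv : ContDiff ℝ 1 v) :
    ∃! q : MvPolynomial (Fin 2) ℝ, q.totalDegree ≤ N ∧
      (∀ p : MvPolynomial (Fin 2) ℝ, p.totalDegree ≤ N →
        ∫ x in P, ⟪gradient (polyEval p) x, gradient (polyEval q) x⟫
          = ∫ x in P, ⟪gradient (polyEval p) x, gradient v x⟫) ∧
      (∫ x in P, polyEval q x) = ∫ x in P, v x := by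
  classical
  let V := MvPolynomial.restrictTotalDegree (Fin 2) ℝ N
  let T : V →ₗ[ℝ] Module.Dual ℝ V :=
    (LinearMap.lcomp ℝ ℝ V.subtype).comp ((formLin P hPbdd).comp V.subtype)
  have hT : ∀ q p : V, T q p = formLin P hPbdd q p := fun _ _ => rfl
  have hinj : Function.Injective T := by
    rw [injective_iff_map_eq_zero]
    intro q hq
    have : formLin P hPbdd q q = 0 := by rw [← hT, hq]; rfl
    exact Subtype.ext (formLin_definite hPne hPopen hPbdd hPconn _ this)
  have hsurj : Function.Surjective T :=
    (LinearMap.injective_iff_surjective_of_finrank_eq_finrank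
      Subspace.dual_finrank_eq.symm).1 hinj
  let F : MvPolynomial (Fin 2) ℝ →ₗ[ℝ] ℝ :=
    pairLin P hPbdd v hv + (∫ x in P, v x) • intLin P hPbdd
  have hF : ∀ p, F p = gradInt P (polyEval p) v + (∫ x in P, v x) * ∫ x in P, polyEval p x :=
    fun _ => rfl
  obtain ⟨q, hq⟩ := hsurj (F.comp V.subtype)
  have key : ∀ p : MvPolynomial (Fin 2) ℝ, p.totalDegree ≤ N →
      gradInt P (polyEval p) (polyEval q) + (∫ x in P, polyEval q x) * (∫ x in P, polyEval p x)
      = gradInt P (polyEval p) v + (∫ x in P, v x) * ∫ x in P, polyEval p x := by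
    intro p hp
    have hpV : p ∈ V := (MvPolynomial.mem_restrictTotalDegree _ _ _).2 hp
    have := LinearMap.congr_fun hq ⟨p, hpV⟩
    exact this
  have hmean : (∫ x in P, polyEval q x) = ∫ x in P, v x := by
    have h1 := key 1 (by simp)
    have e : polyEval (1 : MvPolynomial (Fin 2) ℝ) = fun _ => 1 := by ext x; simp [polyEval]
    have g0 : ∀ g, gradInt P (polyEval 1) g = 0 := by
      intro g; unfold gradInt; rw [e]; simp [gradient_fun_const]
    rw [g0, g0, e] at h1
    have hvp := vol_pos hPne hPopen hPbdd
    simp only [zero_add, integral_const, smul_eq_mul, mul_one, measureReal_restrict_apply_univ]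
      at h1
    exact mul_right_cancel₀ hvp.ne' h1
  refine ⟨q, ⟨(MvPolynomial.mem_restrictTotalDegree _ _ _).1 q.2, ?_, hmean⟩, ?_⟩
  · intro p hp
    have := key p hp
    rw [hmean] at this
    exact add_right_cancel this
  · rintro r ⟨hr, hr1, hr2⟩
    have hrV : r ∈ V := (MvPolynomial.mem_restrictTotalDegree _ _ _).2 hr
    have : (⟨r, hrV⟩ : V) = q := by
      apply hinj
      rw [hq]
      refine LinearMap.ext fun p => ?_
      have hp := hr1 p ((MvPolynomial.mem_restrictTotalDegree _ _ _).1 p.2)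
      change formLin P hPbdd r p = F p
      rw [formLin_apply, hF, hr2]
      exact congrArg (· + _) hp
    exact congrArg Subtype.val this
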